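/- arXiv:2211.13933 — 7 statements merged into one kernel-verified Lean document; each statement's English description precedes it below -/
import Mathlib

section
/- Let N ≥ 2 be an integer and let x, y be reals with 0 < x < y ≤ 2/N. Then sin(Nπy/2)/sin(πy/2) < sin(Nπx/2)/sin(πx/2); i.e., the normalized Dirichlet function Ξ_N is strictly decreasing on the half main lobe (0, 2/N] (and, by evenness, strictly increasing on [−2/N, 0)). -/
/-- If `sin (n v) sin u ≤ sin (n u) sin v` with `n ≥ 1`, then the strict inequality holds at
`n + 1`, provided `(n + 1) v ≤ π`. -/
theorem sin_succ_mul_mul_sin_lt {n : ℕ} (hn : 1 ≤ n) {u v : ℝ} (hu : 0 < u) (huv : u < v)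
    (hv : (n + 1 : ℝ) * v ≤ Real.pi)
    (h : Real.sin (n * v) * Real.sin u ≤ Real.sin (n * u) * Real.sin v) :
    Real.sin ((n + 1 : ℝ) * v) * Real.sin u < Real.sin ((n + 1 : ℝ) * u) * Real.sin v := by
  have hn' : (1 : ℝ) ≤ n := by exact_mod_cast hn
  have hv0 : 0 < v := hu.trans huv
  have hnv : (n : ℝ) * v ≤ Real.pi := by linarith
  have hv2 : v ≤ Real.pi / 2 := by nlinarith
  have hsu : 0 < Real.sin u := Real.sin_pos_of_pos_of_lt_pi hu (by linarith [Real.pi_pos])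
  have hsv : 0 < Real.sin v := Real.sin_pos_of_pos_of_lt_pi hv0 (by linarith [Real.pi_pos])
  have hcu : 0 ≤ Real.cos u := Real.cos_nonneg_of_mem_Icc ⟨by linarith, by linarith⟩
  have hcuv : Real.cos v ≤ Real.cos u :=
    Real.cos_le_cos_of_nonneg_of_le_pi hu.le (by linarith) huv.le
  have hsnv : 0 ≤ Real.sin (n * v) := Real.sin_nonneg_of_nonneg_of_le_pi (by positivity) hnv
  have hcn : Real.cos (n * v) < Real.cos (n * u) :=
    Real.cos_lt_cos_of_nonneg_of_le_pi (by positivity) hnv (by gcongr)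
  rw [add_mul, add_mul, one_mul, one_mul, Real.sin_add, Real.sin_add]
  linarith [mul_le_mul_of_nonneg_left hcuv (mul_nonneg hsnv hsu.le),
    mul_le_mul_of_nonneg_right h hcu, mul_lt_mul_of_pos_right hcn (mul_pos hsu hsv)]

theorem sin_natCast_mul_mul_sin_lt {n : ℕ} (hn : 2 ≤ n) {u v : ℝ} (hu : 0 < u) (huv : u < v)
    (hv : (n : ℝ) * v ≤ Real.pi) :
    Real.sin (n * v) * Real.sin u < Real.sin (n * u) * Real.sin v := by
  induction n, hn using Nat.le_induction with
  | base =>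
    have := sin_succ_mul_mul_sin_lt le_rfl hu huv (by push_cast at hv ⊢; linarith)
      (by simp [mul_comm])
    norm_num at this ⊢
    exact this
  | succ k hk ih =>
    push_cast at hv ⊢
    exact sin_succ_mul_mul_sin_lt (by omega) hu huv hv (ih (by linarith)).le

/-- The normalized Dirichlet function is strictly decreasing on the half main
lobe `(0, 2/N]`: for `0 < x < y ≤ 2/N`,
`sin(Nπy/2)/sin(πy/2) < sin(Nπx/2)/sin(πx/2)`. -/
theorem stmt_4 (N : ℕ) (hN : 2 ≤ N) (x y : ℝ)
    (hx : 0 < x) (hxy : x < y) (hy : y ≤ 2 / N) :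
    Real.sin (N * Real.pi * y / 2) / Real.sin (Real.pi * y / 2) <
      Real.sin (N * Real.pi * x / 2) / Real.sin (Real.pi * x / 2) := by
  have hpi := Real.pi_pos
  have hN' : (2 : ℝ) ≤ N := by exact_mod_cast hN
  have hyN : y * N ≤ 2 := (le_div_iff₀ (by linarith)).1 hy
  have hy1 : y ≤ 1 := by nlinarith
  have hu : 0 < Real.pi * x / 2 := by positivity
  have huv : Real.pi * x / 2 < Real.pi * y / 2 := by gcongr
  have hvpi : Real.pi * y / 2 < Real.pi := by nlinarith
  have key := sin_natCast_mul_mul_sin_lt hN hu huv (by nlinarith)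
  rw [div_lt_div_iff₀ (Real.sin_pos_of_pos_of_lt_pi (hu.trans huv) hvpi)
    (Real.sin_pos_of_pos_of_lt_pi hu (huv.trans hvpi))]
  rwa [mul_assoc (N : ℝ), mul_assoc (N : ℝ), mul_div_assoc (N : ℝ), mul_div_assoc (N : ℝ)]
end

section
/- Let f_c > 0, f_d > 0, M ≥ 1 an integer with f_c > M·f_d, P > 0, θ0 ≥ 0, α > 0, and set ψ = θ0 + (M f_d/f_c)·α and t = θ0 + (f_c/(M f_d))·α (forward pairing). For each integer m with −M ≤ m ≤ M put f_m = f_c + m f_d, θ^{(1)}_{c,m} = (f_c/f_m)·ψ, θ^{(2)}_{c,m} = (f_c/f_m)·ψ + (m f_d/f_m)·t, and W^{(1)}_m = 2f_c/(P f_m). Then the constraint |θ^{(2)}_{c,m} − θ^{(1)}_{c,m}| ≤ W^{(1)}_m/2 for all m ∈ {−M, …, M} holds if and only if α ≤ 1/P − (M f_d/f_c)·θ0. -/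
/-- With subcarrier frequency `f + d > 0`, the offset `d / (f + d) * t` lies within half the
mainlobe width `2 * f / (P * (f + d))` iff `|d| * t ≤ f / P`. -/
theorem abs_offset_le_half_width_iff {f d P s t : ℝ} (hfd : 0 < f + d) (ht : 0 ≤ t) :
    |(s + d / (f + d) * t) - s| ≤ 2 * f / (P * (f + d)) / 2 ↔ |d| * t ≤ f / P := by
  have hwidth : 2 * f / (P * (f + d)) / 2 = f / P / (f + d) := by
    rw [div_div f P]
    ring
  rw [hwidth, add_sub_cancel_left, abs_mul, abs_div, abs_of_pos hfd, abs_of_nonneg ht,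
    div_mul_eq_mul_div, div_le_div_iff_of_pos_right hfd]

/-- The extreme-subcarrier bound, solved for `α`. -/
theorem mul_delay_slope_le_iff {f b P θ α : ℝ} (hf : 0 < f) (hb : 0 < b) :
    b * (θ + f / b * α) ≤ f / P ↔ α ≤ 1 / P - b / f * θ := by
  have hleft : b * (θ + f / b * α) = f * (b / f * θ + α) := by
    field_simp
  rw [hleft, ← mul_one_div f P, mul_le_mul_iff_right₀ hf, le_sub_iff_add_le']

/-- Under the forward pairing `ψ = θ0 + (M f_d/f_c)·α`, `t = θ0 + (f_c/(M f_d))·α`,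
the mainlobe constraint `|θ^{(2)}_{c,m} − θ^{(1)}_{c,m}| ≤ W^{(1)}_m/2` for all
subcarriers holds iff `α ≤ 1/P − (M f_d/f_c)·θ0`. -/
theorem stmt_7 (fc fd P : ℝ) (M : ℤ) (hfc : 0 < fc) (hfd : 0 < fd) (hM : 1 ≤ M)
    (hMfd : (M : ℝ) * fd < fc) (hP : 0 < P)
    (θ0 : ℝ) (hθ0 : 0 ≤ θ0) (α : ℝ) (hα : 0 < α) :
    (∀ m : ℤ, -M ≤ m → m ≤ M →
      |((fc / (fc + (m : ℝ) * fd)) * (θ0 + ((M : ℝ) * fd / fc) * α) +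
          ((m : ℝ) * fd / (fc + (m : ℝ) * fd)) * (θ0 + (fc / ((M : ℝ) * fd)) * α)) -
        (fc / (fc + (m : ℝ) * fd)) * (θ0 + ((M : ℝ) * fd / fc) * α)| ≤
        (2 * fc / (P * (fc + (m : ℝ) * fd))) / 2) ↔
    α ≤ 1 / P - ((M : ℝ) * fd / fc) * θ0 := by
  have hM0 : (0 : ℝ) < M := by exact_mod_cast hM
  have hb : 0 < (M : ℝ) * fd := mul_pos hM0 hfd
  have ht : 0 ≤ θ0 + fc / ((M : ℝ) * fd) * α := by positivity
  rw [← mul_delay_slope_le_iff hfc hb]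
  constructor
  · intro h
    have hmax := h M (by lia) le_rfl
    rwa [abs_offset_le_half_width_iff (add_pos hfc hb) ht, abs_of_pos hb] at hmax
  · intro h m hm₁ hm₂
    have habs : |(m : ℝ) * fd| ≤ M * fd := by
      rw [abs_mul, abs_of_pos hfd]
      gcongr
      exact_mod_cast abs_le.mpr ⟨hm₁, hm₂⟩
    have hfreq : 0 < fc + (m : ℝ) * fd := by linarith [(abs_le.mp habs).1]
    rw [abs_offset_le_half_width_iff hfreq ht]
    exact (mul_le_mul_of_nonneg_right habs ht).trans h
end

section
/- Let f_c > 0, f_d > 0, M ≥ 1 an integer with f_c > M·f_d, P > 0, and θ0, α real, and set ψ = θ0 − (M f_d/f_c)·α and t = θ0 − (f_c/(M f_d))·α (backward pairing). For each integer m with −M ≤ m ≤ M put f_m = f_c + m f_d, θ^{(1)}_{c,m} = (f_c/f_m)·ψ, θ^{(2)}_{c,m} = (f_c/f_m)·ψ + (m f_d/f_m)·t, and W^{(1)}_m = 2f_c/(P f_m). Then the constraint |θ^{(2)}_{c,m} − θ^{(1)}_{c,m}| ≤ W^{(1)}_m/2 for all m ∈ {−M, …, M} holds if and only if (M f_d/f_c)·θ0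 − 1/P ≤ α ≤ (M f_d/f_c)·θ0 + 1/P; in particular, for θ0 ≥ 0 the admissible searching radius extends up to 1/P + (M f_d/f_c)·θ0. -/
/-- A mainlobe offset `(a / f) * t` is within half the mainlobe width `2 * fc / (P * f)` iff
`|a * t| ≤ fc / P`: the subcarrier frequency `f` cancels. -/
theorem abs_mainlobe_offset_le_iff {f : ℝ} (hf : 0 < f) (fc P x a t : ℝ) :
    |(x + a / f * t) - x| ≤ (2 * fc / (P * f)) / 2 ↔ |a * t| ≤ fc / P := by
  have h₁ : (x + a / f * t) - x = a * t / f := by ring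
  have h₂ : (2 * fc / (P * f)) / 2 = fc / P / f := by
    rw [mul_div_assoc, mul_div_cancel_left₀ _ two_ne_zero, div_div]
  rw [h₁, h₂, abs_div, abs_of_pos hf, div_le_div_iff_of_pos_right hf]

/-- The constraint at the edge subcarrier, with `a = M * fd`, bounds the searching radius. -/
theorem abs_edge_offset_le_iff {fc a : ℝ} (hfc : 0 < fc) (ha : 0 < a) (P θ α : ℝ) :
    |a * (θ - fc / a * α)| ≤ fc / P ↔ a / fc * θ - 1 / P ≤ α ∧ α ≤ a / fc * θ + 1 / P := by
  have h : a * (θ - fc / a * α) = fc * (a / fc * θ - α) := by field_simp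
  rw [h, abs_mul, abs_of_pos hfc, div_eq_mul_one_div fc P, mul_le_mul_iff_right₀ hfc, abs_le]
  constructor <;> rintro ⟨h₁, h₂⟩ <;> constructor <;> linarith

/-- Under the backward pairing `ψ = θ0 − (M f_d/f_c)·α`, `t = θ0 − (f_c/(M f_d))·α`,
the mainlobe constraint `|θ^{(2)}_{c,m} − θ^{(1)}_{c,m}| ≤ W^{(1)}_m/2` for all
subcarriers holds iff `(M f_d/f_c)·θ0 − 1/P ≤ α ≤ (M f_d/f_c)·θ0 + 1/P`. -/
theorem stmt_8 (fc fd P : ℝ) (M : ℤ) (hfc : 0 < fc) (hfd : 0 < fd) (hM : 1 ≤ M)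
    (hMfd : (M : ℝ) * fd < fc) (hP : 0 < P) (θ0 α : ℝ) :
    (∀ m : ℤ, -M ≤ m → m ≤ M →
      |((fc / (fc + (m : ℝ) * fd)) * (θ0 - ((M : ℝ) * fd / fc) * α) +
          ((m : ℝ) * fd / (fc + (m : ℝ) * fd)) * (θ0 - (fc / ((M : ℝ) * fd)) * α)) -
        (fc / (fc + (m : ℝ) * fd)) * (θ0 - ((M : ℝ) * fd / fc) * α)| ≤
        (2 * fc / (P * (fc + (m : ℝ) * fd))) / 2) ↔
    (((M : ℝ) * fd / fc) * θ0 - 1 / P ≤ α ∧ α ≤ ((M : ℝ) * fd / fc) * θ0 + 1 / P) := by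
  have hM₀ : (0 : ℝ) < M := by exact_mod_cast (by lia : 0 < M)
  rw [← abs_edge_offset_le_iff hfc (mul_pos hM₀ hfd)]
  constructor
  · intro h
    exact (abs_mainlobe_offset_le_iff (by positivity) _ _ _ _ _).1 (h M (by lia) le_rfl)
  · intro h m hm₁ hm₂
    have hm₁' : -(M : ℝ) ≤ m := by exact_mod_cast hm₁
    have hm₂' : (m : ℝ) ≤ M := by exact_mod_cast hm₂
    have hf : 0 < fc + (m : ℝ) * fd := by
      linarith [mul_le_mul_of_nonneg_right hm₁' hfd.le]
    refine (abs_mainlobe_offset_le_iff hf _ _ _ _ _).2 (le_trans ?_ h)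
    rw [abs_mul, abs_mul, abs_mul, abs_mul, abs_of_pos hM₀]
    gcongr
    exact abs_le.2 ⟨hm₁', hm₂'⟩
end

section
/- (Lemma 1, part 1) Let f_c > 0, f_d > 0, M ≥ 1 an integer with f_c > M·f_d, P > 0, and θ0, α real. Put f_{−M} = f_c − M f_d, f_M = f_c + M f_d, θ^{Side}_{−M} = θ0 + α − 2f_c/(P f_{−M}), θ^{Side}_{M} = θ0 − α + 2f_c/(P f_M), and θ_c = θ0 − (M f_d/f_c)·α. Then the weighted mean identity (f_{−M}·θ^{Side}_{−M} + f_M·θ^{Side}_{M})/(f_{−M} + f_M) = θ_c holds. Consequently f_{−M}·(θ^{Side}_{−M} − θ_c) = −f_M·(θ^{Side}_{M} − θ_c), so θ^{Side}_{−M} − θ_c and θ^{Side}_{M} − θ_c have opposite signs (or both vanish); i.e., the periodic sidelobes of the windowing factor at subcarriers f_{−M} and f_M lie on different sides of the line θ = θ_c. -/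
/-- (Lemma 1, part 1) The periodic sidelobes at subcarriers `f_{−M}` and `f_M`
lie on different sides of `θ_c = θ0 − (M f_d/f_c)·α`: the weighted-mean identity
holds, hence `f_{−M}(θ^{Side}_{−M} − θ_c) = −f_M(θ^{Side}_M − θ_c)` and the two
offsets have opposite signs (or both vanish). -/
theorem stmt_10 (fc fd P : ℝ) (M : ℤ) (hfc : 0 < fc) (hfd : 0 < fd) (hM : 1 ≤ M)
    (hMfd : (M : ℝ) * fd < fc) (hP : 0 < P) (θ0 α : ℝ) :
    ((fc - (M : ℝ) * fd) * (θ0 + α - 2 * fc / (P * (fc - (M : ℝ) * fd))) +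
        (fc + (M : ℝ) * fd) * (θ0 - α + 2 * fc / (P * (fc + (M : ℝ) * fd)))) /
        ((fc - (M : ℝ) * fd) + (fc + (M : ℝ) * fd)) =
      θ0 - ((M : ℝ) * fd / fc) * α ∧
    (fc - (M : ℝ) * fd) *
        ((θ0 + α - 2 * fc / (P * (fc - (M : ℝ) * fd))) - (θ0 - ((M : ℝ) * fd / fc) * α)) =
      -((fc + (M : ℝ) * fd) *
        ((θ0 - α + 2 * fc / (P * (fc + (M : ℝ) * fd))) - (θ0 - ((M : ℝ) * fd / fc) * α))) ∧
    ((θ0 + α - 2 * fc / (P * (fc - (M : ℝ) * fd))) - (θ0 - ((M : ℝ) * fd / fc) * α)) *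
        ((θ0 - α + 2 * fc / (P * (fc + (M : ℝ) * fd))) - (θ0 - ((M : ℝ) * fd / fc) * α)) ≤ 0 := by
  have hMpos : (0 : ℝ) < M := by exact_mod_cast hM
  have hm : 0 < fc - (M : ℝ) * fd := sub_pos.mpr hMfd
  have hp : 0 < fc + (M : ℝ) * fd := by positivity
  have hbalance : (fc - (M : ℝ) * fd) *
        ((θ0 + α - 2 * fc / (P * (fc - (M : ℝ) * fd))) - (θ0 - ((M : ℝ) * fd / fc) * α)) =
      -((fc + (M : ℝ) * fd) *
        ((θ0 - α + 2 * fc / (P * (fc + (M : ℝ) * fd))) - (θ0 - ((M : ℝ) * fd / fc) * α))) := by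
    have := hm.ne'
    have := hp.ne'
    field_simp
    ring
  refine ⟨?_, hbalance, ?_⟩
  · rw [div_eq_iff (add_pos hm hp).ne']
    linear_combination hbalance
  · generalize (θ0 + α - 2 * fc / (P * (fc - (M : ℝ) * fd))) - (θ0 - ((M : ℝ) * fd / fc) * α) = x
      at hbalance ⊢
    generalize (θ0 - α + 2 * fc / (P * (fc + (M : ℝ) * fd))) - (θ0 - ((M : ℝ) * fd / fc) * α) = y
      at hbalance ⊢
    have hxy : (fc - (M : ℝ) * fd) * (x * y) = -((fc + (M : ℝ) * fd) * y ^ 2) := by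
      linear_combination y * hbalance
    have hle : (fc - (M : ℝ) * fd) * (x * y) ≤ 0 := by
      rw [hxy, neg_nonpos]
      positivity
    exact nonpos_of_mul_nonpos_right hle hm
end

section
/- Let f_c > 0, f_d > 0, M ≥ 1 an integer with f_c > M·f_d, P > 0, α > 0, and θ0 real; set ψ = θ0 − (M f_d/f_c)·α and t = θ0 − (f_c/(M f_d))·α (backward pairing), f_{−M} = f_c − M f_d, f_M = f_c + M f_d, θ^{Side}_{M} = θ0 − α + 2f_c/(P f_M). Then f′ := P f_{−M} f_M² / (P f_{−M} f_M + 2 M f_d f_c/α) is positive and satisfies θ^{Side}_{M} = (f_c/f′)·ψ + ((f′ − f_c)/f′)·t; i.e., f′ is the frequency whose mainlobe peak direction equals the sidelobe location θ^{Side}_{M}. -/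
/-- The frequency `f′ = P f_{−M} f_M² / (P f_{−M} f_M + 2 M f_d f_c/α)` is
positive and its mainlobe peak direction equals the sidelobe location
`θ^{Side}_M = θ0 − α + 2f_c/(P f_M)` under the backward pairing. -/
theorem stmt_12 (fc fd P : ℝ) (M : ℤ) (hfc : 0 < fc) (hfd : 0 < fd) (hM : 1 ≤ M)
    (hMfd : (M : ℝ) * fd < fc) (hP : 0 < P) (α : ℝ) (hα : 0 < α) (θ0 : ℝ) :
    let fmm : ℝ := fc - (M : ℝ) * fd
    let fM : ℝ := fc + (M : ℝ) * fd
    let ψ : ℝ := θ0 - ((M : ℝ) * fd / fc) * α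
    let t : ℝ := θ0 - (fc / ((M : ℝ) * fd)) * α
    let θSideM : ℝ := θ0 - α + 2 * fc / (P * fM)
    let f' : ℝ := P * fmm * fM ^ 2 / (P * fmm * fM + 2 * (M : ℝ) * fd * fc / α)
    0 < f' ∧ θSideM = (fc / f') * ψ + ((f' - fc) / f') * t := by
  intro fmm fM ψ t θSideM f'
  have hb : 0 < (M : ℝ) * fd := mul_pos (by exact_mod_cast hM) hfd
  have hM0 : (M : ℝ) ≠ 0 := left_ne_zero_of_mul hb.ne'
  have hfmm : 0 < fmm := sub_pos.2 hMfd
  have hfM : 0 < fM := add_pos hfc hb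
  have hD : 0 < P * fmm * fM + 2 * (M : ℝ) * fd * fc / α := by
    rw [mul_assoc 2 (M : ℝ) fd]
    positivity
  have hf' : 0 < f' := div_pos (by positivity) hD
  refine ⟨hf', ?_⟩
  have hpeak : (fc / f') * ψ + ((f' - fc) / f') * t
      = θ0 - fc / (M * fd) * α + α * (fmm * fM) / (M * fd) * (1 / f') := by
    simp only [ψ, t, fmm, fM]
    field_simp
    ring
  have hinv : 1 / f' = (P * fmm * fM + 2 * (M : ℝ) * fd * fc / α) / (P * fmm * fM ^ 2) :=
    one_div_div _ _
  rw [hpeak, hinv]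
  simp only [θSideM]
  have hfc_eq : fc = fmm + M * fd := by simp only [fmm]; ring
  clear_value fmm fM
  field_simp
  rw [hfc_eq]
  ring
end

section
/- (Key implication in the proof of Theorem 1) Let f_c > 0, f_d > 0, M ≥ 1 an integer with f_c > M·f_d, P > 0, α > 0, and θ0 real. Put f_{−M} = f_c − M f_d, f_M = f_c + M f_d, and f′ = P f_{−M} f_M² / (P f_{−M} f_M + 2 M f_d f_c/α). Then the inequality 2α − M f_d·(1/f′ + 1/f_M)·α − 4f_c/(P f_M) < (M f_d/f_M)·θ0 holds if and only if α < 2/P + M² f_d²/(P f_{−M} f_M) + (M f_d/(2 f_c))·θ0. Hence the intra-fraction interference condition yields the closed-form searching-radius bound α < 2/P + M² f_d²/(P (f_c² − M² f_d²)) + (M f_d/(2 f_c))·θ0. -/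
/-- (Key implication in the proof of Theorem 1) With
`f′ = P f_{−M} f_M²/(P f_{−M} f_M + 2M f_d f_c/α)`, the inequality
`2α − M f_d(1/f′ + 1/f_M)α − 4f_c/(P f_M) < (M f_d/f_M)θ0` holds iff
`α < 2/P + M²f_d²/(P f_{−M} f_M) + (M f_d/(2f_c))θ0`; hence the closed-form
searching-radius bound `α < 2/P + M²f_d²/(P(f_c² − M²f_d²)) + (M f_d/(2f_c))θ0`. -/
theorem stmt_13 (fc fd P : ℝ) (M : ℤ) (hfc : 0 < fc) (hfd : 0 < fd) (hM : 1 ≤ M)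
    (hMfd : (M : ℝ) * fd < fc) (hP : 0 < P) (α : ℝ) (hα : 0 < α) (θ0 : ℝ) :
    let fmm : ℝ := fc - (M : ℝ) * fd
    let fM : ℝ := fc + (M : ℝ) * fd
    let f' : ℝ := P * fmm * fM ^ 2 / (P * fmm * fM + 2 * (M : ℝ) * fd * fc / α)
    ((2 * α - (M : ℝ) * fd * (1 / f' + 1 / fM) * α - 4 * fc / (P * fM) <
        ((M : ℝ) * fd / fM) * θ0) ↔
      (α < 2 / P + ((M : ℝ) ^ 2 * fd ^ 2) / (P * fmm * fM) +
        ((M : ℝ) * fd / (2 * fc)) * θ0)) ∧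
    ((2 * α - (M : ℝ) * fd * (1 / f' + 1 / fM) * α - 4 * fc / (P * fM) <
        ((M : ℝ) * fd / fM) * θ0) →
      α < 2 / P + ((M : ℝ) ^ 2 * fd ^ 2) / (P * (fc ^ 2 - (M : ℝ) ^ 2 * fd ^ 2)) +
        ((M : ℝ) * fd / (2 * fc)) * θ0) := by
  intro fmm fM f'
  have hMr : (0 : ℝ) < M := by exact_mod_cast (by omega : 0 < M)
  have hd : 0 < (M : ℝ) * fd := mul_pos hMr hfd
  have hfmm : 0 < fmm := sub_pos.mpr hMfd
  have hfM : 0 < fM := add_pos hfc hd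
  have hinv : 1 / f' = 1 / fM + 2 * (M : ℝ) * fd * fc / (α * P * fmm * fM ^ 2) := by
    simp only [f', one_div_div]
    field_simp
  have hprod : fc ^ 2 - (M : ℝ) ^ 2 * fd ^ 2 = fmm * fM := by
    simp only [fmm, fM]
    ring
  have hdiff : 2 * α - (M : ℝ) * fd * (1 / f' + 1 / fM) * α - 4 * fc / (P * fM) -
      ((M : ℝ) * fd / fM) * θ0 =
      (2 * fc / fM) * (α - (2 / P + ((M : ℝ) ^ 2 * fd ^ 2) / (P * fmm * fM) +
        ((M : ℝ) * fd / (2 * fc)) * θ0)) := by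
    have hα_coeff : 2 * α - 2 * ((M : ℝ) * fd) / fM * α = 2 * fc / fM * α := by
      field_simp
      simp only [fM]
      ring
    rw [hinv]
    clear_value f' fmm fM
    rw [mul_sub (2 * fc / fM), ← hα_coeff]
    field_simp
    ring
  have hiff : (2 * α - (M : ℝ) * fd * (1 / f' + 1 / fM) * α - 4 * fc / (P * fM) <
        ((M : ℝ) * fd / fM) * θ0) ↔
      (α < 2 / P + ((M : ℝ) ^ 2 * fd ^ 2) / (P * fmm * fM) +
        ((M : ℝ) * fd / (2 * fc)) * θ0) := by
    have hcoeff : 0 < 2 * fc / fM := by positivity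
    rw [← sub_neg, hdiff, ← sub_neg (a := α)]
    exact ⟨fun h => neg_of_mul_neg_right h hcoeff.le, mul_neg_of_pos_of_neg hcoeff⟩
  refine ⟨hiff, fun h => ?_⟩
  rw [hprod, ← mul_assoc]
  exact hiff.mp h
end

section
/- Let f_c > 0, f_d > 0, M ≥ 1 an integer with f_c > M·f_d, and α ≥ 0. Then the backward delay slope t^{bw}(θ0) = θ0 − (f_c/(M f_d))·α lies in the interval [−1, 1] for every central angle θ0 ∈ [0, 1] if and only if α ≤ M f_d/f_c. Hence the largest angle-independent (fixed) searching radius compatible with the beamforming codebook t ∈ [−1, 1] is α̂^{fixed} = M f_d/f_c. -/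
/-- The backward delay slope `t^{bw}(θ0) = θ0 − (f_c/(M f_d))·α` lies in
`[−1, 1]` for every central angle `θ0 ∈ [0, 1]` iff `α ≤ M f_d/f_c`; hence the
largest fixed searching radius compatible with the beamforming codebook
`t ∈ [−1, 1]` is `α̂ = M f_d/f_c`. -/
theorem stmt_19 (fc fd : ℝ) (M : ℤ) (hfc : 0 < fc) (hfd : 0 < fd) (hM : 1 ≤ M)
    (hMfd : (M : ℝ) * fd < fc) (α : ℝ) (hα : 0 ≤ α) :
    (∀ θ0 : ℝ, 0 ≤ θ0 → θ0 ≤ 1 →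
      -1 ≤ θ0 - (fc / ((M : ℝ) * fd)) * α ∧ θ0 - (fc / ((M : ℝ) * fd)) * α ≤ 1) ↔
    α ≤ (M : ℝ) * fd / fc := by
  have hM' : (0 : ℝ) < M := by exact_mod_cast (by lia : 0 < M)
  have hMd : 0 < (M : ℝ) * fd := mul_pos hM' hfd
  have key : fc / ((M : ℝ) * fd) * α ≤ 1 ↔ α ≤ (M : ℝ) * fd / fc := by
    rw [div_mul_eq_mul_div, div_le_one hMd, le_div_iff₀ hfc, mul_comm]
  have hnonneg : 0 ≤ fc / ((M : ℝ) * fd) * α := by positivity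
  rw [← key]
  constructor
  · intro h
    linarith [(h 0 le_rfl zero_le_one).1]
  · intro h θ0 h0 h1
    constructor <;> linarith
end
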